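/- Let N ≥ 3, let Ω ⊆ ℝ^N be a bounded open set, let 0 < μ ≤ μ*, and let 1 ≤ p < 2N/(N−2). Then there exists a constant C = C(p, Ω) > 0 such that for every test function φ on Ω, ( ∫_Ω |φ(x)|^p dx )^{2/p} ≤ C · ( ∫_Ω ‖∇φ(x)‖² dx − μ ∫_Ω φ(x)²/‖x‖² dx ). (The space H_μ(Ω) embeds continuously into L^p(Ω) for all subcritical p.) -/

import Mathlib

open MeasureTheory

lemma aux_int0 {N : ℕ} (hN : 3 ≤ N) (t r : ℝ) (ht : -(N:ℝ) < t) :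
    IntegrableOn (fun x : EuclideanSpace ℝ (Fin N) => ‖x‖ ^ t) (Metric.ball 0 r) := by
  have : Nontrivial (EuclideanSpace ℝ (Fin N)) := by
    have : Nonempty (Fin N) := ⟨⟨0, by omega⟩⟩
    infer_instance
  have := (integrableOn_fun_norm_addHaar (volume : Measure (EuclideanSpace ℝ (Fin N)))
    (f := fun y : ℝ => y ^ t) (r := r)).2
  apply this
  rw [finrank_euclideanSpace_fin]
  by_cases hr : r ≤ 0
  · rw [Set.Ioo_eq_empty (by linarith)]; exact integrableOn_empty
  push Not at hr
  have h1 : IntegrableOn (fun y : ℝ => y ^ ((N:ℝ) - 1 + t)) (Set.Ioo 0 r) :=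
    (intervalIntegral.integrableOn_Ioo_rpow_iff hr).2 (by linarith)
  refine h1.congr_fun (fun y hy => ?_) measurableSet_Ioo
  have hy0 : 0 < y := hy.1
  simp only [smul_eq_mul]
  rw [Real.rpow_add hy0, ← Real.rpow_natCast y (N-1), Nat.cast_sub (by omega)]
  simp

lemma aux_int1 {N : ℕ} (hN : 3 ≤ N) (t : ℝ) (ht : -(N:ℝ) < t)
    (g : EuclideanSpace ℝ (Fin N) → ℝ) (hg : Continuous g) (hc : HasCompactSupport g) :
    Integrable (fun x => g x * ‖x‖ ^ t) := by
  obtain ⟨R, hR⟩ := hc.isBounded.subset_ball 0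
  obtain ⟨M, hM⟩ := hg.bounded_above_of_compact_support hc
  have h0 := (aux_int0 hN t R ht).integrable_indicator measurableSet_ball
  refine (h0.const_mul M).mono' ?_ (Filter.Eventually.of_forall fun x => ?_)
  · apply Measurable.aestronglyMeasurable
    exact hg.measurable.mul (measurable_norm.pow_const t)
  · by_cases hx : x ∈ Metric.ball (0 : EuclideanSpace ℝ (Fin N)) R
    · simp only [Set.indicator_of_mem hx, norm_mul]
      rw [Real.norm_of_nonneg (Real.rpow_nonneg (norm_nonneg x) t)]
      exact mul_le_mul_of_nonneg_right (hM x) (Real.rpow_nonneg (norm_nonneg x) t)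
    · have : g x = 0 := by
        by_contra h
        exact hx (hR (subset_tsupport g h))
      simp [Set.indicator_of_notMem hx, this]

lemma aux_div {N : ℕ} (hN : 3 ≤ N) (t : ℝ) (ht : -(N:ℝ) < t)
    (f : EuclideanSpace ℝ (Fin N) → ℝ) (hf : ContDiff ℝ 1 f) (hc : HasCompactSupport f) :
    ∫ x, fderiv ℝ f x x * ‖x‖ ^ t = -((N:ℝ) + t) * ∫ x, f x * ‖x‖ ^ t := by
  obtain ⟨R₀, hR₀⟩ := hc.isBounded.subset_ball 0
  set R := max R₀ 1
  have hR : tsupport f ⊆ Metric.ball 0 R :=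
    hR₀.trans (Metric.ball_subset_ball (le_max_left _ _))
  have hRpos : 0 < R := lt_of_lt_of_le one_pos (le_max_right _ _)
  have hf' : Continuous (fderiv ℝ f) := hf.continuous_fderiv (by norm_num)
  obtain ⟨M, hM⟩ := hf'.bounded_above_of_compact_support (hc.fderiv ℝ)
  have hM0 : 0 ≤ M := (norm_nonneg _).trans (hM 0)
  have key := hasDerivAt_integral_of_dominated_loc_of_deriv_le
    (μ := (volume : Measure (EuclideanSpace ℝ (Fin N))))
    (F := fun (s : ℝ) x => f (s • x) * ‖x‖ ^ t)
    (F' := fun (s : ℝ) x => fderiv ℝ f (s • x) x * ‖x‖ ^ t)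
    (x₀ := 1) (s := Metric.ball 1 (1/2))
    (bound := (Metric.ball 0 (2*R)).indicator (fun x => M * (2*R) * ‖x‖ ^ t))
    (Metric.ball_mem_nhds 1 (by norm_num))
    (Filter.Eventually.of_forall fun s => by
      apply Measurable.aestronglyMeasurable
      exact (hf.continuous.comp (continuous_const_smul s)).measurable.mul
        (measurable_norm.pow_const t))
    (by simpa using aux_int1 hN t ht f hf.continuous hc)
    (by
      apply Measurable.aestronglyMeasurable
      have : Continuous (fun x : EuclideanSpace ℝ (Fin N) => fderiv ℝ f ((1:ℝ) • x) x) :=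
        (hf'.comp (continuous_const_smul (1:ℝ))).clm_apply continuous_id
      exact this.measurable.mul (measurable_norm.pow_const t))
    (Filter.Eventually.of_forall fun x s hs => by
      have hs2 : 1/2 < s := by
        rw [Metric.mem_ball, Real.dist_eq, abs_lt] at hs
        linarith [hs.1]
      by_cases hx : x ∈ Metric.ball (0 : EuclideanSpace ℝ (Fin N)) (2*R)
      · rw [Set.indicator_of_mem hx, norm_mul,
          Real.norm_of_nonneg (Real.rpow_nonneg (norm_nonneg x) t)]
        refine mul_le_mul_of_nonneg_right ?_ (Real.rpow_nonneg (norm_nonneg x) t)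
        refine (ContinuousLinearMap.le_opNorm _ _).trans ?_
        rw [mem_ball_zero_iff] at hx
        exact mul_le_mul (hM _) hx.le (norm_nonneg _) hM0
      · rw [Set.indicator_of_notMem hx]
        have : fderiv ℝ f (s • x) = 0 := by
          by_contra h
          have h2 := hR (support_fderiv_subset ℝ h)
          rw [mem_ball_zero_iff, norm_smul, Real.norm_of_nonneg (by linarith)] at h2
          rw [mem_ball_zero_iff, not_lt] at hx
          nlinarith
        simp [this])
    (IntegrableOn.integrable_indicator ((aux_int0 hN t (2*R) ht).const_mul (M * (2*R)))
      measurableSet_ball)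
    (Filter.Eventually.of_forall fun x s hs => by
      have h1 : HasDerivAt (fun s : ℝ => s • x) x s := by
        simpa using (hasDerivAt_id s).smul_const x
      have h2 : HasFDerivAt f (fderiv ℝ f (s • x)) (s • x) :=
        (hf.differentiable (by norm_num) _).hasFDerivAt
      exact (h2.comp_hasDerivAt s h1).mul_const _)
  have h1 := key.2
  simp only [one_smul] at h1
  have h3 : ∀ s : ℝ, 0 < s → ∫ x, f (s • x) * ‖x‖ ^ t =
      s ^ (-((N:ℝ) + t)) * ∫ x, f x * ‖x‖ ^ t := by
    intro s hs
    have h4 : ∀ x : EuclideanSpace ℝ (Fin N), f (s • x) * ‖x‖ ^ t =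
        s ^ (-t) * (f (s • x) * ‖s • x‖ ^ t) := by
      intro x
      rw [norm_smul, Real.norm_of_nonneg hs.le, Real.mul_rpow hs.le (norm_nonneg _),
        Real.rpow_neg hs.le]
      have := (Real.rpow_pos_of_pos hs t).ne'
      field_simp
    simp_rw [h4]
    rw [integral_const_mul, Measure.integral_comp_smul_of_nonneg volume
      (fun x => f x * ‖x‖ ^ t) s (hR := hs.le), finrank_euclideanSpace_fin, smul_eq_mul,
      ← mul_assoc, neg_add, Real.rpow_add hs, Real.rpow_neg hs.le (N:ℝ), Real.rpow_natCast]
    ring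
  have h5 : HasDerivAt (fun s : ℝ => s ^ (-((N:ℝ) + t)) * ∫ x, f x * ‖x‖ ^ t)
      (-((N:ℝ) + t) * ∫ x, f x * ‖x‖ ^ t) 1 := by
    have := (Real.hasDerivAt_rpow_const (x := 1) (p := -((N:ℝ) + t)) (Or.inl one_ne_zero)).mul_const
      (∫ x, f x * ‖x‖ ^ t)
    simpa using this
  have h6 := h5.congr_of_eventuallyEq (f₁ := fun s : ℝ => ∫ x, f (s • x) * ‖x‖ ^ t) (by
    filter_upwards [lt_mem_nhds (one_pos : (0:ℝ) < 1)] with s hs using h3 s hs)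
  exact h1.unique h6

lemma aux_sq {N : ℕ} (hN : 3 ≤ N) (ε β : ℝ) (hε : 0 ≤ ε)
    (φ : EuclideanSpace ℝ (Fin N) → ℝ) (hφ : ContDiff ℝ 1 φ) (hc : HasCompactSupport φ) :
    Integrable (fun x => ‖gradient φ x + (β * φ x / ‖x‖ ^ 2) • x‖ ^ 2 * ‖x‖ ^ ε) ∧
    ∫ x, ‖gradient φ x + (β * φ x / ‖x‖ ^ 2) • x‖ ^ 2 * ‖x‖ ^ ε =
      (∫ x, ‖gradient φ x‖ ^ 2 * ‖x‖ ^ ε) +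
        (β ^ 2 - β * ((N:ℝ) - 2 + ε)) * ∫ x, φ x ^ 2 * ‖x‖ ^ (ε - 2) := by
  have : Nontrivial (EuclideanSpace ℝ (Fin N)) := by
    have : Nonempty (Fin N) := ⟨⟨0, by omega⟩⟩
    infer_instance
  have hN' : (3:ℝ) ≤ N := by exact_mod_cast hN
  have hdiff : Differentiable ℝ φ := hφ.differentiable (by norm_num)
  have hfd : Continuous (fderiv ℝ φ) := hφ.continuous_fderiv (by norm_num)
  have hgn : ∀ x, ‖gradient φ x‖ = ‖fderiv ℝ φ x‖ := fun x => by
    rw [gradient, LinearIsometryEquiv.norm_map]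
  have hf2 : ContDiff ℝ 1 (fun x => φ x ^ 2) := hφ.pow 2
  have hc2 : HasCompactSupport (fun x => φ x ^ 2) :=
    hc.comp_left (g := fun y : ℝ => y ^ 2) (by norm_num)
  have hin : ∀ x, fderiv ℝ (fun x => φ x ^ 2) x x = 2 * φ x * inner ℝ (gradient φ x) x := by
    intro x
    rw [inner_gradient_left, ((hdiff x).hasFDerivAt.pow 2).fderiv]
    simp
  have i1 : Integrable (fun x => ‖gradient φ x‖ ^ 2 * ‖x‖ ^ ε) := by
    simp_rw [hgn]
    refine aux_int1 hN ε (by linarith) _ (hfd.norm.pow 2) ?_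
    exact (hc.fderiv ℝ).comp_left (g := fun y => ‖y‖ ^ 2) (by simp)
  have i2 : Integrable (fun x => fderiv ℝ (fun x => φ x ^ 2) x x * ‖x‖ ^ (ε - 2)) := by
    refine aux_int1 hN _ (by linarith) _ 
      ((hf2.continuous_fderiv (by norm_num)).clm_apply continuous_id) ?_
    refine (hc2.fderiv ℝ).mono ?_
    intro x hx h
    exact hx (by simp [h])
  have i3 : Integrable (fun x => φ x ^ 2 * ‖x‖ ^ (ε - 2)) :=
    aux_int1 hN _ (by linarith) _ hf2.continuous hc2
  have hae : (fun x => ‖gradient φ x + (β * φ x / ‖x‖ ^ 2) • x‖ ^ 2 * ‖x‖ ^ ε) =ᵐ[volume]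
      (fun x => ‖gradient φ x‖ ^ 2 * ‖x‖ ^ ε +
        (β * (fderiv ℝ (fun x => φ x ^ 2) x x * ‖x‖ ^ (ε - 2)) +
        β ^ 2 * (φ x ^ 2 * ‖x‖ ^ (ε - 2)))) := by
    filter_upwards [Measure.ae_ne volume (0 : EuclideanSpace ℝ (Fin N))] with x hx
    have hx' : 0 < ‖x‖ := norm_pos_iff.2 hx
    rw [hin, norm_add_sq_real, inner_smul_right, norm_smul, Real.rpow_sub hx', Real.rpow_two,
      mul_pow, Real.norm_eq_abs, sq_abs]
    field_simp
    ring
  refine ⟨(i1.add ((i2.const_mul β).add (i3.const_mul (β^2)))).congr hae.symm, ?_⟩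
  have i4 : Integrable (fun x => β * (fderiv ℝ (fun x => φ x ^ 2) x x * ‖x‖ ^ (ε - 2)) +
        β ^ 2 * (φ x ^ 2 * ‖x‖ ^ (ε - 2))) := (i2.const_mul β).add (i3.const_mul (β^2))
  rw [integral_congr_ae hae, integral_add i1 i4,
    integral_add (i2.const_mul β) (i3.const_mul (β^2)), integral_const_mul, integral_const_mul,
    aux_div hN _ (by linarith) _ hf2 hc2]
  ring

lemma aux_K {N : ℕ} (hN : 3 ≤ N) (ε R : ℝ) (hε : 0 < ε) (hR : 0 < R)
    (φ : EuclideanSpace ℝ (Fin N) → ℝ) (hφ : ContDiff ℝ 1 φ) (hc : HasCompactSupport φ)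
    (hs : tsupport φ ⊆ Metric.ball 0 R) :
    ∫ x, ‖gradient φ x‖ ^ 2 * ‖x‖ ^ ε ≤
      (R ^ ε * (1 + ((((N:ℝ)-2)/2)^2 + ((N:ℝ)-2)/2 * ε) * (4 / ε^2))) *
       ((∫ x, ‖gradient φ x‖ ^ 2) - (((N:ℝ)-2)/2)^2 * ∫ x, φ x ^ 2 / ‖x‖ ^ 2) := by
  have hN' : (3:ℝ) ≤ N := by exact_mod_cast hN
  set a : ℝ := ((N:ℝ)-2)/2 with ha
  have hNa : (N:ℝ) - 2 = 2 * a := by rw [ha]; ring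
  have ha0 : 0 < a := by rw [ha]; linarith
  obtain ⟨i1, e1⟩ := aux_sq hN 0 a le_rfl φ hφ hc
  obtain ⟨i2, e2⟩ := aux_sq hN ε a hε.le φ hφ hc
  obtain ⟨i3, e3⟩ := aux_sq hN ε (a + ε/2) hε.le φ hφ hc
  have p3 : 0 ≤ ∫ x, ‖gradient φ x + ((a + ε/2) * φ x / ‖x‖ ^ 2) • x‖ ^ 2 * ‖x‖ ^ ε :=
    integral_nonneg fun x => by positivity
  have p2 : ∫ x, ‖gradient φ x + (a * φ x / ‖x‖ ^ 2) • x‖ ^ 2 * ‖x‖ ^ ε ≤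
      R ^ ε * ∫ x, ‖gradient φ x + (a * φ x / ‖x‖ ^ 2) • x‖ ^ 2 * ‖x‖ ^ (0:ℝ) := by
    rw [← integral_const_mul]
    refine integral_mono i2 (i1.const_mul _) fun x => ?_
    simp only [Real.rpow_zero, mul_one]
    by_cases hx : x ∈ tsupport φ
    · have := mem_ball_zero_iff.1 (hs hx)
      rw [mul_comm]
      gcongr
    · have h1 : φ x = 0 := image_eq_zero_of_notMem_tsupport hx
      have h2 : fderiv ℝ φ x = 0 := by
        by_contra h
        exact hx (support_fderiv_subset ℝ h)
      simp [gradient, h1, h2]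
  rw [hNa] at e1 e2 e3
  rw [e3] at p3
  rw [e1, e2] at p2
  have q1 : ∫ x, φ x ^ 2 * ‖x‖ ^ ((0:ℝ) - 2) = ∫ x, φ x ^ 2 / ‖x‖ ^ 2 := by
    congr 1; ext x
    rw [zero_sub, Real.rpow_neg (norm_nonneg x), Real.rpow_two, div_eq_mul_inv]
  simp only [q1, Real.rpow_zero, mul_one] at p2
  set K := ∫ x, ‖gradient φ x‖ ^ 2 * ‖x‖ ^ ε
  set J := ∫ x, φ x ^ 2 * ‖x‖ ^ (ε - 2)
  set D₁ := ∫ x, ‖gradient φ x‖ ^ 2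
  set D₂ := ∫ x, φ x ^ 2 / ‖x‖ ^ 2
  set P := R ^ ε
  have p2' : K ≤ P * (D₁ - a^2 * D₂) + (a^2 + a*ε) * J := by linarith
  have p3' : ε^2/4 * J ≤ P * (D₁ - a^2 * D₂) := by nlinarith
  have hJ : J ≤ 4/ε^2 * (P * (D₁ - a^2 * D₂)) := by
    calc J = 4/ε^2 * (ε^2/4*J) := by field_simp
      _ ≤ _ := by gcongr
  have : (a^2+a*ε) * J ≤ (a^2+a*ε) * (4/ε^2 * (P * (D₁ - a^2 * D₂))) := by gcongr
  linarith

lemma aux_restrict {X F : Type*} [MeasurableSpace X] [NormedAddCommGroup F] (μ : Measure X)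
    (f : X → F) (s : Set X) (p : ENNReal) (h : Function.support f ⊆ s) :
    eLpNorm f p μ = eLpNorm f p (μ.restrict s) :=
  (eLpNorm_restrict_eq_of_support_subset h).symm

set_option maxHeartbeats 1000000 in
lemma aux_main {N : ℕ} (hN : 3 ≤ N) (R p : ℝ) (hR : 0 < R) (hp1 : 1 ≤ p)
    (hp2 : p < 2 * N / ((N : ℝ) - 2)) :
    ∃ ε C : ℝ, 0 < ε ∧ 0 ≤ C ∧ ∀ φ : EuclideanSpace ℝ (Fin N) → ℝ,
      ContDiff ℝ 1 φ → HasCompactSupport φ → tsupport φ ⊆ Metric.ball 0 R →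
      (∫ x, |φ x| ^ p) ^ (2 / p) ≤ C * ∫ x, ‖gradient φ x‖ ^ 2 * ‖x‖ ^ ε := by
  have : Nontrivial (EuclideanSpace ℝ (Fin N)) := by
    have : Nonempty (Fin N) := ⟨⟨0, by omega⟩⟩
    infer_instance
  have hN' : (3:ℝ) ≤ N := by exact_mod_cast hN
  have hp0 : 0 < p := by linarith
  obtain ⟨κ, hκ1, hκ2, hκ3⟩ : ∃ κ : ℝ, κ ≤ 1 ∧ 1/2 < κ ∧ κ - (N:ℝ)⁻¹ ≤ p⁻¹ := by
    refine ⟨min 1 (p⁻¹ + (N:ℝ)⁻¹), min_le_left _ _, lt_min (by norm_num) ?_, ?_⟩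
    · rw [lt_div_iff₀ (by linarith)] at hp2
      have : p⁻¹ + (N:ℝ)⁻¹ = (N + p) / (p * N) := by field_simp
      rw [this, lt_div_iff₀ (by positivity)]
      linarith
    · linarith [min_le_right 1 (p⁻¹ + (N:ℝ)⁻¹)]
  have hκ0 : 0 < κ := by linarith
  set ε := 2 * κ - 1 with hε
  have hε0 : 0 < ε := by linarith
  obtain ⟨P, hPc⟩ : ∃ P : NNReal, (P : ℝ) = p := ⟨⟨p, hp0.le⟩, rfl⟩
  obtain ⟨Q, e2⟩ : ∃ Q : NNReal, (Q : ℝ) = κ⁻¹ := ⟨⟨κ⁻¹, by positivity⟩, rfl⟩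
  have hP : ((P : NNReal) : ENNReal).toReal = p := by rw [ENNReal.coe_toReal, hPc]
  have hQ2 : κ⁻¹ < 2 := by
    rw [inv_lt_comm₀ hκ0 (by norm_num)]; linarith
  obtain ⟨S, e1⟩ : ∃ S : NNReal, (S : ℝ) = 2 / ε := ⟨⟨2 / ε, by positivity⟩, rfl⟩
  let ν : Measure (EuclideanSpace ℝ (Fin N)) := volume.restrict (Metric.ball 0 R)
  let w : EuclideanSpace ℝ (Fin N) → ℝ := fun x => ‖x‖ ^ (-(ε/2))
  have hw : MemLp w S ν := by
    have hS0 : (S : ENNReal) ≠ 0 := by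
      rw [Ne, ENNReal.coe_eq_zero]
      intro h
      have : (2:ℝ) / ε = 0 := by rw [← e1, h, NNReal.coe_zero]
      have : 0 < 2 / ε := by positivity
      linarith
    rw [← integrable_norm_rpow_iff
      (measurable_norm.pow_const _).aestronglyMeasurable hS0 ENNReal.coe_ne_top]
    refine (aux_int0 hN (-1) R (by linarith)).congr (Filter.Eventually.of_forall fun x => ?_)
    have hS : (S : ENNReal).toReal = 2 / ε := by rw [ENNReal.coe_toReal, e1]
    simp only [hS, w]
    rw [Real.norm_of_nonneg (Real.rpow_nonneg (norm_nonneg x) _), ← Real.rpow_mul (norm_nonneg x)]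
    congr 1
    field_simp
  have hT : ENNReal.HolderTriple (S : ENNReal) 2 (Q : ENNReal) := by
    have hQ0 : Q ≠ 0 := by
      intro h
      have : κ⁻¹ = 0 := by rw [← e2, h, NNReal.coe_zero]
      have : 0 < κ⁻¹ := by positivity
      linarith
    have hS0 : S ≠ 0 := by
      intro h
      have : (2:ℝ) / ε = 0 := by rw [← e1, h, NNReal.coe_zero]
      have : 0 < 2 / ε := by positivity
      linarith
    constructor
    have h2 : (2 : ENNReal) = ((2 : NNReal) : ENNReal) := rfl
    rw [h2, ← ENNReal.coe_inv hQ0, ← ENNReal.coe_inv hS0, ← ENNReal.coe_inv (by norm_num),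
      ← ENNReal.coe_add, ENNReal.coe_inj]
    apply NNReal.eq
    push_cast
    rw [e1, e2, inv_inv, inv_div, hε]
    ring
  obtain ⟨Ac, hAc⟩ : ∃ Ac : NNReal, Ac = eLpNormLESNormFDerivOfLeConst ℝ
    (volume : Measure (EuclideanSpace ℝ (Fin N))) (Metric.ball 0 R) Q P := ⟨_, rfl⟩
  obtain ⟨A, hA⟩ : ∃ A : ℝ, A = (Ac : ℝ) := ⟨_, rfl⟩
  have hA0 : 0 ≤ A := by rw [hA]; exact Ac.2
  set W : ℝ := (eLpNorm w S ν).toReal with hW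
  refine ⟨ε, (A * W) ^ 2, hε0, by positivity, fun φ hφ hc hs => ?_⟩
  have hgn : ∀ x, ‖gradient φ x‖ = ‖fderiv ℝ φ x‖ := fun x => by
    rw [gradient, LinearIsometryEquiv.norm_map]
  have hfd : Continuous (fderiv ℝ φ) := hφ.continuous_fderiv (by norm_num)
  have hsub : Function.support φ ⊆ Metric.ball 0 R := (subset_tsupport φ).trans hs
  have g1 := eLpNorm_le_eLpNorm_fderiv_of_le
    (volume : Measure (EuclideanSpace ℝ (Fin N))) (u := φ) (s := Metric.ball 0 R) (p := Q) (q := P)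
    hφ hsub (by
      rw [← NNReal.coe_le_coe, e2]
      exact (one_le_inv₀ hκ0).2 hκ1) (by
      rw [finrank_euclideanSpace_fin, ← NNReal.coe_lt_coe, e2]
      push_cast
      linarith) (by
      rw [finrank_euclideanSpace_fin, hPc, NNReal.coe_inv, e2, inv_inv]; exact hκ3) Metric.isBounded_ball
  rw [← hAc] at g1
  have hsub' : Function.support (fderiv ℝ φ) ⊆ Metric.ball 0 R :=
    (support_fderiv_subset ℝ).trans hs
  have g2 : eLpNorm (fderiv ℝ φ) Q volume = eLpNorm (fderiv ℝ φ) Q ν :=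
    aux_restrict volume (fderiv ℝ φ) (Metric.ball 0 R) Q hsub'
  let v : EuclideanSpace ℝ (Fin N) → (EuclideanSpace ℝ (Fin N) →L[ℝ] ℝ) :=
    fun x => (‖x‖ ^ (ε/2)) • fderiv ℝ φ x
  have hvm : AEStronglyMeasurable v volume :=
    (measurable_norm.pow_const _).aestronglyMeasurable.smul hfd.aestronglyMeasurable
  have g3 : eLpNorm (fderiv ℝ φ) Q ν = eLpNorm (w • v) Q ν := by
    apply eLpNorm_congr_ae
    refine ae_restrict_of_ae ?_
    filter_upwards [Measure.ae_ne volume (0 : EuclideanSpace ℝ (Fin N))] with x hx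
    have hx' : 0 < ‖x‖ := norm_pos_iff.2 hx
    simp only [Pi.smul_apply', w, v, smul_smul]
    rw [← Real.rpow_add hx']
    simp
  have g4 : eLpNorm (w • v) Q ν ≤ eLpNorm w S ν * eLpNorm v 2 ν :=
    eLpNorm_smul_le_mul_eLpNorm hvm.restrict hw.1
  have hvsq : ∀ x, ‖v x‖ ^ 2 = ‖gradient φ x‖ ^ 2 * ‖x‖ ^ ε := by
    intro x
    simp only [v]
    rw [hgn, norm_smul, mul_pow, Real.norm_of_nonneg (Real.rpow_nonneg (norm_nonneg x) _),
      ← Real.rpow_natCast, ← Real.rpow_mul (norm_nonneg x), mul_comm]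
    congr 2
    push_cast; ring
  have hv2 : MemLp v 2 volume := by
    rw [memLp_two_iff_integrable_sq_norm hvm]
    simp_rw [hvsq, hgn]
    refine aux_int1 hN ε (by linarith) _ (hfd.norm.pow 2) ?_
    exact (hc.fderiv ℝ).comp_left (g := fun y => ‖y‖ ^ 2) (by simp)
  have g5 : eLpNorm v 2 ν ≤ eLpNorm v 2 volume := eLpNorm_restrict_le _ _ _ _
  have g6 : eLpNorm v 2 volume = ENNReal.ofReal (√(∫ x, ‖gradient φ x‖ ^ 2 * ‖x‖ ^ ε)) := by
    rw [hv2.eLpNorm_eq_integral_rpow_norm (by norm_num) (by norm_num)]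
    simp only [ENNReal.toReal_ofNat, Real.rpow_two, hvsq]
    rw [Real.sqrt_eq_rpow, one_div]
  have hP0 : (P : ENNReal) ≠ 0 := by
    rw [Ne, ENNReal.coe_eq_zero]
    intro h
    have : p = 0 := by rw [← hPc, h, NNReal.coe_zero]
    linarith
  have g7 : eLpNorm φ P volume = ENNReal.ofReal ((∫ x, |φ x| ^ p) ^ p⁻¹) := by
    rw [(hφ.continuous.memLp_of_hasCompactSupport hc).eLpNorm_eq_integral_rpow_norm hP0
      ENNReal.coe_ne_top]
    simp only [hP, Real.norm_eq_abs]
  set K := ∫ x, ‖gradient φ x‖ ^ 2 * ‖x‖ ^ ε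
  have hK : 0 ≤ K := integral_nonneg fun x => by positivity
  have hI : 0 ≤ ∫ x, |φ x| ^ p := integral_nonneg fun x => by positivity
  have g8 : ENNReal.ofReal ((∫ x, |φ x| ^ p) ^ p⁻¹) ≤ ENNReal.ofReal (A * (W * √K)) := by
    rw [← g7, ENNReal.ofReal_mul (by positivity), ENNReal.ofReal_mul (by positivity), hW,
      ENNReal.ofReal_toReal hw.2.ne, ← g6, hA, ENNReal.ofReal_coe_nnreal]
    refine g1.trans ?_
    rw [g2, g3]
    gcongr
    exact g4.trans (by gcongr)
  rw [ENNReal.ofReal_le_ofReal_iff (by positivity)] at g8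
  calc (∫ x, |φ x| ^ p) ^ (2 / p) = ((∫ x, |φ x| ^ p) ^ p⁻¹) ^ 2 := by
        rw [← Real.rpow_natCast, ← Real.rpow_mul hI]
        congr 1
        push_cast; ring
    _ ≤ (A * (W * √K)) ^ 2 := by gcongr
    _ = (A * W) ^ 2 * K := by
        rw [← mul_assoc, mul_pow, Real.sq_sqrt hK]

/-- **Continuous embedding `H_μ(Ω) ↪ L^p(Ω)` for subcritical `p`.**
For `N ≥ 3`, a bounded open `Ω ⊆ ℝ^N` and `1 ≤ p < 2N/(N−2)`, there is
`C = C(p, Ω) > 0` such that for every `0 < μ ≤ μ*` and every test function `φ` on `Ω`,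
`(∫_Ω |φ|^p)^{2/p} ≤ C (∫_Ω ‖∇φ‖² − μ ∫_Ω φ²/‖x‖²)`. -/
theorem Hmu_embeds_Lp (N : ℕ) (hN : 3 ≤ N)
    (Ω : Set (EuclideanSpace ℝ (Fin N))) (hΩo : IsOpen Ω) (hΩb : Bornology.IsBounded Ω)
    (p : ℝ) (hp1 : 1 ≤ p) (hp2 : p < 2 * N / ((N : ℝ) - 2)) :
    ∃ C : ℝ, 0 < C ∧
      ∀ μ : ℝ, 0 < μ → μ ≤ (((N : ℝ) - 2) / 2) ^ 2 →
        ∀ φ : EuclideanSpace ℝ (Fin N) → ℝ,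
          ContDiff ℝ (⊤ : ℕ∞) φ → HasCompactSupport φ → tsupport φ ⊆ Ω →
          (∫ x in Ω, |φ x| ^ p) ^ (2 / p) ≤
            C * ((∫ x in Ω, ‖gradient φ x‖ ^ 2) - μ * ∫ x in Ω, (φ x) ^ 2 / ‖x‖ ^ 2) := by
  have hN' : (3:ℝ) ≤ N := by exact_mod_cast hN
  obtain ⟨R₀, hR₀⟩ := hΩb.subset_ball 0
  set R := max R₀ 1
  have hR : Ω ⊆ Metric.ball 0 R := hR₀.trans (Metric.ball_subset_ball (le_max_left _ _))
  have hRpos : 0 < R := lt_of_lt_of_le one_pos (le_max_right _ _)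
  obtain ⟨ε, C, hε, hC, H⟩ := aux_main hN R p hRpos hp1 hp2
  set c : ℝ := R ^ ε * (1 + ((((N:ℝ)-2)/2)^2 + ((N:ℝ)-2)/2 * ε) * (4 / ε^2)) with hc
  have hc0 : 0 < c := by
    have : 0 < ((N:ℝ)-2)/2 := by linarith
    positivity
  refine ⟨(C + 1) * c, by positivity, fun μ hμ hμ' φ hφ hcs hsup => ?_⟩
  have hφ1 : ContDiff ℝ 1 φ := hφ.of_le (by exact_mod_cast le_top)
  have h0 : ∀ x, x ∉ Ω → φ x = 0 := fun x hx =>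
    image_eq_zero_of_notMem_tsupport fun h => hx (hsup h)
  have h1 : ∀ x, x ∉ Ω → gradient φ x = 0 := fun x hx => by
    have : fderiv ℝ φ x = 0 := by
      by_contra h
      exact hx (hsup (support_fderiv_subset ℝ h))
    simp [gradient, this]
  rw [setIntegral_eq_integral_of_forall_compl_eq_zero (f := fun x => |φ x| ^ p)
      fun x hx => by simp [h0 x hx, (by linarith : p ≠ 0)],
    setIntegral_eq_integral_of_forall_compl_eq_zero (f := fun x => ‖gradient φ x‖ ^ 2)
      fun x hx => by simp [h1 x hx],
    setIntegral_eq_integral_of_forall_compl_eq_zero (f := fun x => φ x ^ 2 / ‖x‖ ^ 2)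
      fun x hx => by simp [h0 x hx]]
  have k1 := H φ hφ1 hcs (hsup.trans hR)
  have k2 := aux_K hN ε R hε hRpos φ hφ1 hcs (hsup.trans hR)
  rw [← hc] at k2
  have hK : 0 ≤ ∫ x, ‖gradient φ x‖ ^ 2 * ‖x‖ ^ ε := integral_nonneg fun x => by positivity
  have hJ : 0 ≤ ∫ x, φ x ^ 2 / ‖x‖ ^ 2 := integral_nonneg fun x => by positivity
  calc _ ≤ _ := k1
    _ ≤ (C + 1) * ∫ x, ‖gradient φ x‖ ^ 2 * ‖x‖ ^ ε := by gcongr; linarith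
    _ ≤ (C + 1) * (c * ((∫ x, ‖gradient φ x‖ ^ 2) -
          (((N:ℝ)-2)/2)^2 * ∫ x, φ x ^ 2 / ‖x‖ ^ 2)) := by gcongr
    _ ≤ (C + 1) * (c * ((∫ x, ‖gradient φ x‖ ^ 2) - μ * ∫ x, φ x ^ 2 / ‖x‖ ^ 2)) := by gcongr
    _ = _ := by ring
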